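/- For all words x, y over {0,1}: if 1·x ~_2 1·y then x·1 ~_2 y·1; and if x·0 ~_2 y·0 then 0·x ~_2 0·y. -/

import Mathlib

/-- Number of occurrences of `v` as a scattered subword (subsequence) of `u`. -/
def binomC {α : Type*} [DecidableEq α] (u v : List α) : ℕ := u.sublists.count v

/-- Two words are 2-binomially equivalent. -/
def binEq2 {α : Type*} [DecidableEq α] (u v : List α) : Prop :=
  ∀ x : List α, x.length ≤ 2 → binomC u x = binomC v x

section

variable {α : Type*} [DecidableEq α]

theorem binomC_cons_nil (a : α) (u : List α) : binomC (a :: u) [] = binomC u [] := by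
  unfold binomC
  rw [(List.sublists_perm_sublists' _).count_eq, (List.sublists_perm_sublists' u).count_eq,
    List.sublists'_cons, List.count_append, Nat.add_eq_left, List.count_eq_zero]
  simp

theorem binomC_cons_cons (a b : α) (u v : List α) :
    binomC (a :: u) (b :: v) = binomC u (b :: v) + if a = b then binomC u v else 0 := by
  unfold binomC
  rw [(List.sublists_perm_sublists' _).count_eq, (List.sublists_perm_sublists' u).count_eq,
    (List.sublists_perm_sublists' u).count_eq, List.sublists'_cons, List.count_append]
  congr 1
  split_ifs with h
  · subst h
    exact List.count_map_of_injective _ _ (List.cons_injective) _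
  · rw [List.count_eq_zero]
    simp [h]

theorem binomC_concat_nil (a : α) (u : List α) : binomC (u ++ [a]) [] = binomC u [] := by
  unfold binomC
  rw [List.sublists_concat, List.count_append, Nat.add_eq_left, List.count_eq_zero]
  simp

theorem binomC_concat_concat (a b : α) (u v : List α) :
    binomC (u ++ [a]) (v ++ [b]) =
      binomC u (v ++ [b]) + if a = b then binomC u v else 0 := by
  unfold binomC
  rw [List.sublists_concat, List.count_append]
  congr 1
  split_ifs with h
  · subst h
    exact List.count_map_of_injective _ _ (List.append_left_injective [a]) _
  · rw [List.count_eq_zero]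
    simp [h]

theorem binEq2_cons_iff (a : α) (x y : List α) : binEq2 (a :: x) (a :: y) ↔ binEq2 x y := by
  constructor
  · intro h v
    induction v with
    | nil => simpa only [binomC_cons_nil] using h []
    | cons b v ih =>
      intro hv
      have hb := h (b :: v) hv
      rw [binomC_cons_cons, binomC_cons_cons, ih (by simp at hv ⊢; omega)] at hb
      exact Nat.add_right_cancel hb
  · rintro h (_ | ⟨b, v⟩) hv
    · simpa only [binomC_cons_nil] using h [] hv
    · rw [binomC_cons_cons, binomC_cons_cons, h _ hv, h v (by simp at hv ⊢; omega)]

theorem binEq2_concat_iff (a : α) (x y : List α) :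
    binEq2 (x ++ [a]) (y ++ [a]) ↔ binEq2 x y := by
  constructor
  · intro h v
    induction v using List.reverseRecOn with
    | nil => simpa only [binomC_concat_nil] using h []
    | append_singleton v b ih =>
      intro hv
      have hb := h (v ++ [b]) hv
      rw [binomC_concat_concat, binomC_concat_concat, ih (by simp at hv ⊢; omega)] at hb
      exact Nat.add_right_cancel hb
  · intro h v hv
    obtain rfl | ⟨v, b, rfl⟩ := List.eq_nil_or_concat' v
    · simpa only [binomC_concat_nil] using h [] hv
    · rw [binomC_concat_concat, binomC_concat_concat, h _ hv, h v (by simp at hv ⊢; omega)]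

end

/-- 2-binomial equivalence is preserved under the cyclic shifts 1x ↦ x1 and x0 ↦ 0x. -/
theorem binEq2_cyclic_shifts (x y : List (Fin 2)) :
    (binEq2 ((1 : Fin 2) :: x) ((1 : Fin 2) :: y) → binEq2 (x ++ [1]) (y ++ [1])) ∧
    (binEq2 (x ++ [0]) (y ++ [0]) → binEq2 ((0 : Fin 2) :: x) ((0 : Fin 2) :: y)) := by
  simp only [binEq2_cons_iff, binEq2_concat_iff, imp_self, and_self]
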